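/- Suppose λ_K · δ_max < K and the step-size parameter satisfies α < ‖I + λL − (λ_K/K)L⁻‖_F^{-1}. Then the gradient descent iterations Y^{(t+1)} = Y^{(t)} − α[(Y^{(t)} − B) + λ L Y^{(t)} − (λ_K/K) L⁻ Y^{(t)}], started from any Y^{(0)} ∈ ℝ^{n×d}, converge to the unique global minimizer of ℓ. -/

import Mathlib

open Matrix Filter

/-- Frobenius norm `‖A‖_F = √(∑ᵢⱼ Aᵢⱼ²)`. -/
noncomputable def frobNorm {m k : Type*} [Fintype m] [Fintype k]
    (A : Matrix m k ℝ) : ℝ :=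
  Real.sqrt (∑ i, ∑ j, (A i j) ^ 2)

/-- The node-embedding energy
`ℓ(Y) = ‖Y − B‖_F² + λ·tr(Yᵀ L Y) − (λ_K/K)·tr(Yᵀ L⁻ Y)`. -/
noncomputable def energy {n d : ℕ} (L Lneg : Matrix (Fin n) (Fin n) ℝ)
    (B : Matrix (Fin n) (Fin d) ℝ) (lam lamK : ℝ) (K : ℕ)
    (Y : Matrix (Fin n) (Fin d) ℝ) : ℝ :=
  ((Y - B)ᵀ * (Y - B)).trace + lam * (Yᵀ * L * Y).trace
    - (lamK / K) * (Yᵀ * Lneg * Y).trace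

/-- A real symmetric matrix is bounded above, in the Loewner order, by any upper bound of its
eigenvalues. -/
theorem Matrix.IsHermitian.posSemidef_smul_one_sub {n : Type*} [Fintype n] [DecidableEq n]
    {A : Matrix n n ℝ} (hA : A.IsHermitian) {δ : ℝ} (hδ : ∀ i, hA.eigenvalues i ≤ δ) :
    (δ • (1 : Matrix n n ℝ) - A).PosSemidef := by
  have hU : (hA.eigenvectorUnitary : Matrix n n ℝ) * (hA.eigenvectorUnitary : Matrix n n ℝ)ᴴ = 1 :=
    Unitary.mul_star_self_of_mem hA.eigenvectorUnitary.2
  have hdiag : (diagonal fun i => δ - hA.eigenvalues i).PosSemidef :=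
    PosSemidef.diagonal fun i => sub_nonneg.2 (hδ i)
  have hspec : A = (hA.eigenvectorUnitary : Matrix n n ℝ) * diagonal hA.eigenvalues
      * (hA.eigenvectorUnitary : Matrix n n ℝ)ᴴ := hA.spectral_theorem
  have hsub : (diagonal fun i => δ - hA.eigenvalues i)
      = δ • (1 : Matrix n n ℝ) - diagonal hA.eigenvalues := by
    rw [smul_one_eq_diagonal, diagonal_sub]
  have h := hdiag.mul_mul_conjTranspose_same (hA.eigenvectorUnitary : Matrix n n ℝ)
  rwa [hsub, mul_sub, sub_mul, ← hspec, mul_smul_comm, mul_one, smul_mul_assoc, hU] at h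

theorem sq_frobNorm {m k : Type*} [Fintype m] [Fintype k] (A : Matrix m k ℝ) :
    frobNorm A ^ 2 = (Aᵀ * A).trace := by
  rw [frobNorm, Real.sq_sqrt (by positivity), Finset.sum_comm]
  simp [trace, mul_apply, sq]

/-- A real symmetric matrix is bounded above, in the Loewner order, by its Frobenius norm. -/
theorem posSemidef_frobNorm_smul_one_sub {n : Type*} [Fintype n] [DecidableEq n]
    {A : Matrix n n ℝ} (hA : A.IsHermitian) :
    (frobNorm A • (1 : Matrix n n ℝ) - A).PosSemidef := by
  refine PosSemidef.of_dotProduct_mulVec_nonneg ((isHermitian_one.smul (.all _)).sub hA) fun x => ?_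
  have hcs := Finset.sum_mul_sq_le_sq_mul_sq (Finset.univ : Finset (n × n))
    (fun p => A p.1 p.2) (fun p => x p.1 * x p.2)
  have hform : x ⬝ᵥ A *ᵥ x = ∑ p : n × n, A p.1 p.2 * (x p.1 * x p.2) := by
    simp only [Fintype.sum_prod_type, dotProduct, mulVec, Finset.mul_sum]
    exact Finset.sum_congr rfl fun i _ => Finset.sum_congr rfl fun j _ => by ring
  have hnorm : ∑ p : n × n, (A p.1 p.2) ^ 2 = frobNorm A ^ 2 := by
    rw [frobNorm, Real.sq_sqrt (by positivity), Fintype.sum_prod_type]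
  have hx : ∑ p : n × n, (x p.1 * x p.2) ^ 2 = (x ⬝ᵥ x) ^ 2 := by
    simp only [Fintype.sum_prod_type, dotProduct, sq, Finset.sum_mul_sum]
    exact Finset.sum_congr rfl fun i _ => Finset.sum_congr rfl fun j _ => by ring
  rw [← hform, hnorm, hx, ← mul_pow] at hcs
  have h0 : 0 ≤ frobNorm A * (x ⬝ᵥ x) :=
    mul_nonneg (Real.sqrt_nonneg _) (by simpa using dotProduct_star_self_nonneg x)
  have := le_of_sq_le_sq hcs h0
  simpa [sub_mulVec, smul_mulVec, dotProduct_sub] using this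

theorem Matrix.PosSemidef.trace_transpose_mul_mul_nonneg {n m : Type*} [Fintype n] [Fintype m]
    {A : Matrix n n ℝ} (hA : A.PosSemidef) (X : Matrix n m ℝ) : 0 ≤ (Xᵀ * A * X).trace := by
  simpa using (hA.conjTranspose_mul_mul_same X).trace_nonneg

/-- For `μ ≤ A` and `α‖A‖_F ≤ 1`, a gradient step `X ↦ X - αAX` contracts the squared Frobenius
norm by the factor `1 - αμ`. -/
theorem trace_sub_smul_mul_le {n m : Type*} [Fintype n] [DecidableEq n] [Fintype m]
    {A : Matrix n n ℝ} {μ α : ℝ} (hA : A.PosSemidef)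
    (hμ : (A - μ • (1 : Matrix n n ℝ)).PosSemidef) (hα0 : 0 ≤ α) (hα : α * frobNorm A ≤ 1)
    (X : Matrix n m ℝ) :
    ((X - α • (A * X))ᵀ * (X - α • (A * X))).trace ≤ (1 - α * μ) * (Xᵀ * X).trace := by
  have hAt : Aᵀ = A := by simpa using hA.isHermitian.eq
  have hlower := hμ.trace_transpose_mul_mul_nonneg X
  have hupper := (posSemidef_frobNorm_smul_one_sub hA.isHermitian).trace_transpose_mul_mul_nonneg
    (A * X)
  have hform := hA.trace_transpose_mul_mul_nonneg (X - α • (A * X))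
  have hsq : 0 ≤ ((A * X)ᵀ * (A * X)).trace := by rw [← sq_frobNorm]; positivity
  simp only [transpose_sub, transpose_smul, transpose_mul, hAt, Matrix.sub_mul, Matrix.mul_sub,
    Matrix.smul_mul, Matrix.mul_smul, trace_sub, trace_smul, smul_eq_mul, Matrix.mul_one,
    ← Matrix.mul_assoc] at *
  set a := (Xᵀ * X).trace
  set b := (Xᵀ * A * X).trace
  set c := (Xᵀ * A * A * X).trace
  set e := (Xᵀ * A * A * A * X).trace
  -- The `A`-form at `X - αAX` is nonnegative, which bounds `α‖AX‖²` by the `A`-form at `X`.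
  have h1 : α * c ≤ b := by
    nlinarith [mul_nonneg (mul_nonneg hα0 hα0) hupper,
      mul_nonneg (mul_nonneg hα0 hsq) (sub_nonneg.2 hα)]
  nlinarith [mul_nonneg hα0 hlower, mul_nonneg hα0 (sub_nonneg.2 h1)]

/-- Expansion of the energy around a critical point. -/
theorem energy_add {n d : ℕ} {L Lneg : Matrix (Fin n) (Fin n) ℝ}
    (hL : Lᵀ = L) (hLneg : Lnegᵀ = Lneg) {B : Matrix (Fin n) (Fin d) ℝ} {lam lamK : ℝ} {K : ℕ}
    {Y : Matrix (Fin n) (Fin d) ℝ} (hY : (1 + lam • L - (lamK / K) • Lneg) * Y = B)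
    (H : Matrix (Fin n) (Fin d) ℝ) :
    energy L Lneg B lam lamK K (Y + H) = energy L Lneg B lam lamK K Y
      + (Hᵀ * (1 + lam • L - (lamK / K) • Lneg) * H).trace := by
  have hcrit : (Hᵀ * ((1 + lam • L - (lamK / K) • Lneg) * Y)).trace = (Hᵀ * B).trace := by rw [hY]
  have hswap (M : Matrix (Fin n) (Fin n) ℝ) (hM : Mᵀ = M) :
      (Yᵀ * M * H).trace = (Hᵀ * M * Y).trace := by
    rw [← trace_transpose (Yᵀ * M * H)]
    simp [transpose_mul, hM, Matrix.mul_assoc]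
  have hswapY : (Yᵀ * H).trace = (Hᵀ * Y).trace := by simpa using hswap 1 transpose_one
  have hswapB : (Bᵀ * H).trace = (Hᵀ * B).trace := by
    rw [← trace_transpose (Bᵀ * H)]
    simp [transpose_mul]
  have hswapL := hswap L hL
  have hswapLneg := hswap Lneg hLneg
  simp only [energy, transpose_sub, transpose_add, Matrix.sub_mul, Matrix.mul_sub, Matrix.add_mul,
    Matrix.mul_add, Matrix.smul_mul, Matrix.mul_smul, trace_sub, trace_add, trace_smul,
    smul_eq_mul, Matrix.mul_one, Matrix.one_mul, ← Matrix.mul_assoc] at *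
  linear_combination 2 * hcrit + hswapY - hswapB + lam * hswapL - lamK / K * hswapLneg

/-- if `λ_K · δ_max < K` and the step-size parameter satisfies
`α < ‖I + λL − (λ_K/K)L⁻‖_F⁻¹`, then the gradient descent iterations
`Y^{(t+1)} = Y^{(t)} − α[(Y^{(t)} − B) + λ L Y^{(t)} − (λ_K/K) L⁻ Y^{(t)}]`,
started from any `Y^{(0)}`, converge to the unique global minimizer of `ℓ`
(convergence in Frobenius norm). -/
theorem gradient_descent_converges_to_unique_min {n d : ℕ}
    (L Lneg : Matrix (Fin n) (Fin n) ℝ)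
    (hL : L.PosSemidef) (hLneg : Lneg.PosSemidef)
    (B : Matrix (Fin n) (Fin d) ℝ)
    (lam lamK : ℝ) (hlam : 0 < lam) (hlamK : 0 ≤ lamK)
    (K : ℕ) (hK : 1 ≤ K)
    (δmax : ℝ) (hδ : IsGreatest (Set.range hLneg.isHermitian.eigenvalues) δmax)
    (hcond : lamK * δmax < (K : ℝ))
    (α : ℝ) (hα0 : 0 < α)
    (hα : α < (frobNorm (1 + lam • L - (lamK / K) • Lneg))⁻¹) :
    ∃ Ystar : Matrix (Fin n) (Fin d) ℝ,
      (∀ Y, energy L Lneg B lam lamK K Ystar ≤ energy L Lneg B lam lamK K Y) ∧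
      (∀ Y', (∀ Y, energy L Lneg B lam lamK K Y' ≤ energy L Lneg B lam lamK K Y) →
        Y' = Ystar) ∧
      ∀ Yseq : ℕ → Matrix (Fin n) (Fin d) ℝ,
        (∀ t, Yseq (t + 1) =
            Yseq t - α • ((Yseq t - B) + lam • (L * Yseq t)
              - (lamK / K) • (Lneg * Yseq t))) →
        Tendsto (fun t => frobNorm (Yseq t - Ystar)) atTop (nhds 0) := by
  have hK0 : (0 : ℝ) < K := by exact_mod_cast hK
  have hc : 0 ≤ lamK / K := by positivity
  set A := 1 + lam • L - (lamK / K) • Lneg with hAdef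
  set μ := 1 - lamK / K * δmax with hμdef
  have hμ0 : 0 < μ := by
    rw [hμdef, sub_pos, div_mul_eq_mul_div, div_lt_one hK0]
    exact hcond
  have hAμ : (A - μ • (1 : Matrix (Fin n) (Fin n) ℝ)).PosSemidef := by
    have hδL := hLneg.isHermitian.posSemidef_smul_one_sub fun i => hδ.2 ⟨i, rfl⟩
    convert (hL.smul hlam.le).add (hδL.smul hc) using 1
    rw [hAdef, hμdef]
    module
  have hA : A.PosDef := by
    simpa using PosDef.posSemidef_add hAμ (PosDef.one.smul hμ0)
  obtain ⟨Ystar, hYstar⟩ : ∃ Y, A * Y = B :=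
    ⟨A⁻¹ * B, mul_nonsing_inv_cancel_left _ _ ((isUnit_iff_isUnit_det A).1 hA.isUnit)⟩
  have henergy (Y : Matrix (Fin n) (Fin d) ℝ) : energy L Lneg B lam lamK K Y =
      energy L Lneg B lam lamK K Ystar + ((Y - Ystar)ᵀ * A * (Y - Ystar)).trace := by
    simpa using energy_add (by simpa using hL.isHermitian.eq)
      (by simpa using hLneg.isHermitian.eq) hYstar (Y - Ystar)
  have hlower (X : Matrix (Fin n) (Fin d) ℝ) : μ * (Xᵀ * X).trace ≤ (Xᵀ * A * X).trace := by
    have h := hAμ.trace_transpose_mul_mul_nonneg X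
    simpa [Matrix.mul_sub, Matrix.sub_mul] using h
  refine ⟨Ystar, fun Y => ?_, fun Y' hY' => ?_, fun Yseq hY => ?_⟩
  · linarith [henergy Y, hA.posSemidef.trace_transpose_mul_mul_nonneg (Y - Ystar)]
  · have hle : μ * frobNorm (Y' - Ystar) ^ 2 ≤ 0 := by
      rw [sq_frobNorm]
      linarith [henergy Y', hY' Ystar, hlower (Y' - Ystar)]
    have hzero : ((Y' - Ystar)ᵀ * (Y' - Ystar)).trace = 0 := by
      rw [← sq_frobNorm]
      nlinarith [sq_nonneg (frobNorm (Y' - Ystar))]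
    rw [← conjTranspose_eq_transpose_of_trivial, trace_conjTranspose_mul_self_eq_zero_iff] at hzero
    exact sub_eq_zero.1 hzero
  · have hF : 0 < frobNorm A := inv_pos.1 (hα0.trans hα)
    have hαF : α * frobNorm A ≤ 1 := ((lt_inv_mul_iff₀' hF).1 (by simpa using hα)).le
    have hstep (t : ℕ) : Yseq (t + 1) - Ystar =
        (Yseq t - Ystar) - α • (A * (Yseq t - Ystar)) := by
      rw [hY t, Matrix.mul_sub, hYstar, hAdef, Matrix.sub_mul, Matrix.add_mul, Matrix.one_mul,
        Matrix.smul_mul, Matrix.smul_mul]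
      module
    set r := max (1 - α * μ) 0
    have hr1 : r < 1 := max_lt (by nlinarith) one_pos
    have hbound (t : ℕ) : frobNorm (Yseq t - Ystar) ^ 2 ≤ frobNorm (Yseq 0 - Ystar) ^ 2 * r ^ t := by
      induction t with
      | zero => simp
      | succ t ih =>
        calc frobNorm (Yseq (t + 1) - Ystar) ^ 2
            ≤ (1 - α * μ) * frobNorm (Yseq t - Ystar) ^ 2 := by
              rw [hstep, sq_frobNorm, sq_frobNorm]
              exact trace_sub_smul_mul_le hA.posSemidef hAμ hα0.le hαF _
          _ ≤ r * frobNorm (Yseq t - Ystar) ^ 2 := by gcongr; exact le_max_left _ _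
          _ ≤ r * (frobNorm (Yseq 0 - Ystar) ^ 2 * r ^ t) := by gcongr
          _ = frobNorm (Yseq 0 - Ystar) ^ 2 * r ^ (t + 1) := by ring
    have hsq : Tendsto (fun t => frobNorm (Yseq t - Ystar) ^ 2) atTop (nhds 0) := by
      refine squeeze_zero (fun t => sq_nonneg _) hbound ?_
      simpa using (tendsto_pow_atTop_nhds_zero_of_lt_one (le_max_right _ _) hr1).const_mul
        (frobNorm (Yseq 0 - Ystar) ^ 2)
    have hnonneg (t : ℕ) : 0 ≤ frobNorm (Yseq t - Ystar) := Real.sqrt_nonneg _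
    simpa [Real.sqrt_sq (hnonneg _)] using hsq.sqrt
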